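/- arXiv:1702.03148 — 2 statements merged into one kernel-verified Lean document; each statement's English description precedes it below -/
import Mathlib

section
/- Let $d \ge 1$, let $v$ be a complex-valued Schwartz function on $\mathbb{R}^d$, and let $\varphi : \mathbb{R}^d \to \mathbb{R}$ be a smooth function whose partial derivatives of every order from $1$ to $3$ are bounded. Then $\mathrm{Re} \int_{\mathbb{R}^d} \nabla \bar v \cdot \nabla(\nabla v \cdot \nabla\varphi)\, dx \;=\; \int_{\mathbb{R}^d} \sum_{j,k=1}^d \partial_j\partial_k\varphi\;\partial_j v\;\partial_k \bar v\, dx \;-\; \frac{1}{2} \int_{\mathbb{R}^d} |\nabla v|^2\, \Delta\varphi\, dx$. -/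
open MeasureTheory Complex
open scoped ENNReal BigOperators RealInnerProductSpace

noncomputable section

abbrev Ed (d : ℕ) := EuclideanSpace ℝ (Fin d)

/-- Fourier transform with convention `(𝓕 f) ξ = ∫ e^{-i x·ξ} f x dx`. -/
def FT {d : ℕ} (f : Ed d → ℂ) (ξ : Ed d) : ℂ :=
  ∫ x : Ed d, Complex.exp (-Complex.I * ((⟪x, ξ⟫ : ℝ) : ℂ)) * f x

/-- Inverse Fourier transform `(2π)^{-d} ∫ e^{i x·ξ} g ξ dξ`. -/
def FTinv {d : ℕ} (g : Ed d → ℂ) (x : Ed d) : ℂ :=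
  (((2 * Real.pi) ^ (-(d : ℝ)) : ℝ) : ℂ) *
    ∫ ξ : Ed d, Complex.exp (Complex.I * ((⟪x, ξ⟫ : ℝ) : ℂ)) * g ξ

/-- Fractional Schrödinger propagator `e^{-it(-Δ)^s}`. -/
def fprop {d : ℕ} (s t : ℝ) (f : Ed d → ℂ) : Ed d → ℂ :=
  FTinv (fun ξ => Complex.exp (-Complex.I * (t : ℂ) * ((‖ξ‖ ^ (2 * s) : ℝ) : ℂ)) * FT f ξ)

/-- Fractional derivative `D^σ = (-Δ)^{σ/2}`, the Fourier multiplier `|ξ|^σ`. -/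
def fracD {d : ℕ} (σ : ℝ) (f : Ed d → ℂ) : Ed d → ℂ :=
  FTinv (fun ξ => ((‖ξ‖ ^ σ : ℝ) : ℂ) * FT f ξ)

/-- `(-Δ)^{β/2} e^{-it(-Δ)^s}`. -/
def fracDProp {d : ℕ} (β s t : ℝ) (f : Ed d → ℂ) : Ed d → ℂ :=
  FTinv (fun ξ => ((‖ξ‖ ^ β : ℝ) : ℂ) *
    Complex.exp (-Complex.I * (t : ℂ) * ((‖ξ‖ ^ (2 * s) : ℝ) : ℂ)) * FT f ξ)

/-- Resolvent `(-Δ + λ)⁻¹`. -/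
def resolv {d : ℕ} (lam : ℝ) (f : Ed d → ℂ) : Ed d → ℂ :=
  FTinv (fun ξ => FT f ξ / ((‖ξ‖ ^ 2 + lam : ℝ) : ℂ))

/-- Resolvent-regularization `u_λ = √(sin(πs)/π) (-Δ+λ)⁻¹ u`. -/
def reg {d : ℕ} (s lam : ℝ) (f : Ed d → ℂ) : Ed d → ℂ :=
  fun x => ((Real.sqrt (Real.sin (Real.pi * s) / Real.pi) : ℝ) : ℂ) * resolv lam f x

/-- A function is radial if its value depends only on `|x|`. -/
def IsRadial {d : ℕ} (f : Ed d → ℂ) : Prop :=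
  ∀ x y : Ed d, ‖x‖ = ‖y‖ → f x = f y

/-- Homogeneous Sobolev norm `‖f‖_{Ḣ^s} = (2π)^{-d/2} ‖ |ξ|^s 𝓕f ‖_{L²}`. -/
def HdotNorm {d : ℕ} (s : ℝ) (f : Ed d → ℂ) : ℝ :=
  (2 * Real.pi) ^ (-(d : ℝ) / 2) *
    (eLpNorm (fun ξ : Ed d => ((‖ξ‖ ^ s : ℝ) : ℂ) * FT f ξ) 2 volume).toReal

/-- Inhomogeneous Sobolev norm `‖f‖_{H^s}² = ‖f‖_{L²}² + ‖f‖_{Ḣ^s}²`. -/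
def HNorm {d : ℕ} (s : ℝ) (f : Ed d → ℂ) : ℝ :=
  Real.sqrt ((eLpNorm f 2 volume).toReal ^ 2 + HdotNorm s f ^ 2)

/-- Mixed space-time norm `L^q_t L^r_x (ℝ × ℝ^d)`. -/
def mixedNorm {d : ℕ} (q r : ℝ≥0∞) (F : ℝ → Ed d → ℂ) : ℝ≥0∞ :=
  eLpNorm (fun t => (eLpNorm (F t) r volume).toReal) q volume

/-- Partial derivative `∂_j` of a complex-valued function. -/
def pd {d : ℕ} (j : Fin d) (f : Ed d → ℂ) (x : Ed d) : ℂ :=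
  fderiv ℝ f x (EuclideanSpace.single j 1)

/-- Partial derivative `∂_j` of a real-valued function. -/
def pdR {d : ℕ} (j : Fin d) (f : Ed d → ℝ) (x : Ed d) : ℝ :=
  fderiv ℝ f x (EuclideanSpace.single j 1)

/-- Laplacian of a real-valued function. -/
def lapR {d : ℕ} (f : Ed d → ℝ) : Ed d → ℝ :=
  fun x => ∑ j : Fin d, pdR j (pdR j f) x

/-- Rescaling `χ_R(x) = χ(x/R)`. -/
def chiR {d : ℕ} (χ : Ed d → ℝ) (R : ℝ) : Ed d → ℝ :=
  fun x => χ (R⁻¹ • x)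


/-- Squared `H^{1/2}` norm `(2π)^{-d} ∫ (1+|ξ|²)^{1/2} |𝓕u(ξ)|² dξ`. -/
def H12sq {d : ℕ} (f : Ed d → ℂ) : ℝ :=
  (2 * Real.pi) ^ (-(d : ℝ)) * ∫ ξ : Ed d, (1 + ‖ξ‖ ^ 2) ^ ((1 : ℝ)/2) * ‖FT f ξ‖ ^ 2

lemma ContDiff.pdR {d : ℕ} {f : Ed d → ℝ} (hf : ContDiff ℝ (⊤ : ℕ∞) f) (j : Fin d) :
    ContDiff ℝ (⊤ : ℕ∞) (pdR j f) :=
  (hf.fderiv_right (m := (⊤ : ℕ∞)) (by simp)).clm_apply contDiff_const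

lemma pdR_pdR_apply {d : ℕ} {f : Ed d → ℝ} (hf : ContDiff ℝ (⊤ : ℕ∞) f) (j k : Fin d)
    (x : Ed d) :
    pdR j (pdR k f) x =
      fderiv ℝ (fderiv ℝ f) x (EuclideanSpace.single j 1) (EuclideanSpace.single k 1) := by
  have h : DifferentiableAt ℝ (fderiv ℝ f) x :=
    (hf.fderiv_right (m := (⊤ : ℕ∞)) (by simp)).differentiable (by simp) x
  change fderiv ℝ (fun y => fderiv ℝ f y (EuclideanSpace.single k 1)) x _ = _
  rw [fderiv_clm_apply h (differentiableAt_const _)]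
  simp

lemma pd_pd_apply {d : ℕ} {f : Ed d → ℂ} (hf : ContDiff ℝ (⊤ : ℕ∞) f) (j k : Fin d)
    (x : Ed d) :
    pd j (pd k f) x =
      fderiv ℝ (fderiv ℝ f) x (EuclideanSpace.single j 1) (EuclideanSpace.single k 1) := by
  have h : DifferentiableAt ℝ (fderiv ℝ f) x :=
    (hf.fderiv_right (m := (⊤ : ℕ∞)) (by simp)).differentiable (by simp) x
  change fderiv ℝ (fun y => fderiv ℝ f y (EuclideanSpace.single k 1)) x _ = _
  rw [fderiv_clm_apply h (differentiableAt_const _)]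
  simp

lemma pdR_comm {d : ℕ} {f : Ed d → ℝ} (hf : ContDiff ℝ (⊤ : ℕ∞) f) (j k : Fin d) (x : Ed d) :
    pdR j (pdR k f) x = pdR k (pdR j f) x := by
  rw [pdR_pdR_apply hf, pdR_pdR_apply hf]
  exact (hf.contDiffAt.isSymmSndFDerivAt (by simpa using WithTop.coe_le_coe.2 (le_top (a := (2 : ℕ∞))))).eq _ _

lemma pd_comm {d : ℕ} {f : Ed d → ℂ} (hf : ContDiff ℝ (⊤ : ℕ∞) f) (j k : Fin d) (x : Ed d) :
    pd j (pd k f) x = pd k (pd j f) x := by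
  rw [pd_pd_apply hf, pd_pd_apply hf]
  exact (hf.contDiffAt.isSymmSndFDerivAt (by simpa using WithTop.coe_le_coe.2 (le_top (a := (2 : ℕ∞))))).eq _ _

lemma abs_pdR_le {d : ℕ} (f : Ed d → ℝ) (j : Fin d) (x : Ed d) :
    |pdR j f x| ≤ ‖iteratedFDeriv ℝ 1 f x‖ := by
  rw [norm_iteratedFDeriv_one]
  simpa [pdR] using (fderiv ℝ f x).le_opNorm (EuclideanSpace.single j 1)

lemma abs_pdR_pdR_le {d : ℕ} {f : Ed d → ℝ} (hf : ContDiff ℝ (⊤ : ℕ∞) f) (j k : Fin d)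
    (x : Ed d) : |pdR j (pdR k f) x| ≤ ‖iteratedFDeriv ℝ 2 f x‖ := by
  rw [pdR_pdR_apply hf, ← norm_iteratedFDeriv_fderiv, norm_iteratedFDeriv_one]
  simpa using (fderiv ℝ (fderiv ℝ f) x).le_opNorm₂ (EuclideanSpace.single j 1)
    (EuclideanSpace.single k 1)

/-- The partial derivative `∂_j` of a Schwartz function, as a Schwartz function. -/
def SchwartzMap.pd {d : ℕ} (j : Fin d) (v : SchwartzMap (Ed d) ℂ) : SchwartzMap (Ed d) ℂ :=
  LineDeriv.lineDerivOp (EuclideanSpace.single j (1 : ℝ)) v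

lemma SchwartzMap.coe_pd {d : ℕ} (j : Fin d) (v : SchwartzMap (Ed d) ℂ) :
    ⇑(v.pd j) = _root_.pd j v :=
  funext fun x => SchwartzMap.lineDerivOp_apply_eq_fderiv _ v x

lemma SchwartzMap.integrable_ofReal_mul_mul_conj {d : ℕ} (a b : SchwartzMap (Ed d) ℂ)
    {m : Ed d → ℝ} (hm : Continuous m) {M : ℝ} (hM : ∀ x, |m x| ≤ M) :
    Integrable fun x => (m x : ℂ) * a x * (starRingEnd ℂ) (b x) := by
  obtain ⟨C, hC⟩ := b.decay 0 0
  refine ((a.integrable (μ := volume)).bdd_mul (c := M)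
    (Complex.continuous_ofReal.comp hm).aestronglyMeasurable
    (.of_forall fun x => by simpa using hM x)).mul_bdd (c := C)
    (Complex.continuous_conj.comp b.continuous).aestronglyMeasurable
    (.of_forall fun x => by simpa using hC.2 x)

lemma SchwartzMap.integrable_mul_norm_sq {d : ℕ} (w : SchwartzMap (Ed d) ℂ)
    {m : Ed d → ℝ} (hm : Continuous m) {M : ℝ} (hM : ∀ x, |m x| ≤ M) :
    Integrable fun x => m x * ‖w x‖ ^ 2 := by
  refine (w.integrable_ofReal_mul_mul_conj w hm hM).re.congr (.of_forall fun x => ?_)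
  simp [mul_assoc, Complex.mul_conj, Complex.normSq_eq_norm_sq, -Complex.ofReal_pow]

lemma SchwartzMap.fderiv_norm_sq {d : ℕ} (w : SchwartzMap (Ed d) ℂ) (x e : Ed d) :
    fderiv ℝ (fun y => ‖w y‖ ^ 2) x e =
      2 * (fderiv ℝ w x e * (starRingEnd ℂ) (w x)).re := by
  rw [(w.hasFDerivAt x).norm_sq.fderiv]
  simp [Complex.inner, mul_add]

lemma SchwartzMap.re_integral_mul_pd_mul_conj {d : ℕ} (w : SchwartzMap (Ed d) ℂ) (j : Fin d)
    {p : Ed d → ℝ} (hp : ContDiff ℝ (⊤ : ℕ∞) p) {M M' : ℝ} (hM : ∀ x, |p x| ≤ M)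
    (hM' : ∀ x, |pdR j p x| ≤ M') :
    (∫ x, (p x : ℂ) * w.pd j x * (starRingEnd ℂ) (w x)).re =
      -(1 / 2 * ∫ x, pdR j p x * ‖w x‖ ^ 2) := by
  have hint := (w.pd j).integrable_ofReal_mul_mul_conj w hp.continuous hM
  have hre : ∀ x, ((p x : ℂ) * w.pd j x * (starRingEnd ℂ) (w x)).re =
      1 / 2 * (p x * fderiv ℝ (fun y => ‖w y‖ ^ 2) x (EuclideanSpace.single j 1)) := by
    intro x
    rw [SchwartzMap.fderiv_norm_sq, SchwartzMap.coe_pd, mul_assoc, Complex.re_ofReal_mul,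
      _root_.pd]
    ring
  have hdiff : Differentiable ℝ fun y => ‖w y‖ ^ 2 := w.differentiable.norm_sq ℝ
  have hpart := integral_mul_fderiv_eq_neg_fderiv_mul_of_integrable (μ := (volume : Measure (Ed d)))
    (v := EuclideanSpace.single j 1) (f := p) (g := fun y => ‖w y‖ ^ 2)
    (w.integrable_mul_norm_sq (hp.pdR j).continuous hM')
    ((hint.re.const_mul 2).congr (.of_forall fun x => by
      simp only [RCLike.re_eq_complex_re, hre]; ring))
    (w.integrable_mul_norm_sq hp.continuous hM)
    (fun x _ => hp.differentiable (by simp) x) (fun x _ => hdiff x)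
  calc (∫ x, (p x : ℂ) * w.pd j x * (starRingEnd ℂ) (w x)).re
      = ∫ x, ((p x : ℂ) * w.pd j x * (starRingEnd ℂ) (w x)).re := (integral_re hint).symm
    _ = -(1 / 2 * ∫ x, pdR j p x * ‖w x‖ ^ 2) := by
      simp_rw [hre]
      rw [integral_const_mul, hpart, mul_neg]
      rfl

lemma SchwartzMap.pd_sum_pd_mul {d : ℕ} (v : SchwartzMap (Ed d) ℂ) {φ : Ed d → ℝ}
    (hφ : ContDiff ℝ (⊤ : ℕ∞) φ) (k : Fin d) (x : Ed d) :
    _root_.pd k (fun y => ∑ j, _root_.pd j v y * ((pdR j φ y : ℝ) : ℂ)) x =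
      ∑ j, ((pdR j φ x : ℂ) * (v.pd k).pd j x + (pdR j (pdR k φ) x : ℂ) * v.pd j x) := by
  have hterm : ∀ j, HasFDerivAt (fun y => v.pd j y * ((pdR j φ y : ℝ) : ℂ))
      (v.pd j x • (Complex.ofRealCLM.comp (fderiv ℝ (pdR j φ) x)) +
        (pdR j φ x : ℂ) • fderiv ℝ (v.pd j) x) x := fun j =>
    ((v.pd j).hasFDerivAt x).mul (Complex.ofRealCLM.hasFDerivAt.comp x
      ((hφ.pdR j).differentiable (by simp) x).hasFDerivAt)
  simp_rw [← SchwartzMap.coe_pd]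
  rw [_root_.pd, (HasFDerivAt.fun_sum fun j _ => hterm j).fderiv, sum_apply]
  refine Finset.sum_congr rfl fun j _ => ?_
  have h₁ : fderiv ℝ (v.pd j) x (EuclideanSpace.single k 1) = (v.pd k).pd j x := by
    rw [SchwartzMap.coe_pd, SchwartzMap.coe_pd, SchwartzMap.coe_pd]
    exact pd_comm v.smooth' k j x
  have h₂ : fderiv ℝ (pdR j φ) x (EuclideanSpace.single k 1) = pdR j (pdR k φ) x :=
    pdR_comm hφ k j x
  simp [h₁, h₂]
  ring

theorem stmt12 (d : ℕ) (hd : 1 ≤ d) (v : SchwartzMap (Ed d) ℂ)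
    (φ : Ed d → ℝ) (hφ : ContDiff ℝ (⊤ : ℕ∞) φ)
    (hbd : ∀ n : ℕ, 1 ≤ n → n ≤ 3 → ∃ M : ℝ, ∀ x : Ed d, ‖iteratedFDeriv ℝ n φ x‖ ≤ M) :
    ((((∫ x : Ed d, ∑ k : Fin d, (starRingEnd ℂ) (pd k (⇑v) x) *
          pd k (fun y => ∑ j : Fin d, pd j (⇑v) y * ((pdR j φ y : ℝ) : ℂ)) x).re : ℝ)) : ℂ)
    = (∫ x : Ed d, ∑ j : Fin d, ∑ k : Fin d, ((pdR j (pdR k φ) x : ℝ) : ℂ) *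
          pd j (⇑v) x * (starRingEnd ℂ) (pd k (⇑v) x))
      - ((((1 : ℝ) / 2 * ∫ x : Ed d, (∑ j : Fin d, ‖pd j (⇑v) x‖ ^ 2) * lapR φ x : ℝ)) : ℂ) := by
  obtain ⟨M₁, hM₁⟩ := hbd 1 le_rfl (by norm_num)
  obtain ⟨M₂, hM₂⟩ := hbd 2 (by norm_num) (by norm_num)
  have hb₁ : ∀ j x, |pdR j φ x| ≤ M₁ := fun j x => (abs_pdR_le φ j x).trans (hM₁ x)
  have hb₂ : ∀ j k x, |pdR j (pdR k φ) x| ≤ M₂ := fun j k x =>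
    (abs_pdR_pdR_le hφ j k x).trans (hM₂ x)
  have hT : ∀ j k, Integrable fun x =>
      (pdR j φ x : ℂ) * (v.pd k).pd j x * (starRingEnd ℂ) (v.pd k x) := fun j k =>
    SchwartzMap.integrable_ofReal_mul_mul_conj _ _ (hφ.pdR j).continuous (hb₁ j)
  have hH : ∀ j k, Integrable fun x =>
      (pdR j (pdR k φ) x : ℂ) * v.pd j x * (starRingEnd ℂ) (v.pd k x) := fun j k =>
    SchwartzMap.integrable_ofReal_mul_mul_conj _ _ ((hφ.pdR k).pdR j).continuous (hb₂ j k)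
  have hN : ∀ j k, Integrable fun x => pdR j (pdR j φ) x * ‖v.pd k x‖ ^ 2 := fun j k =>
    SchwartzMap.integrable_mul_norm_sq _ ((hφ.pdR j).pdR j).continuous (hb₂ j j)
  have hleft : (∫ x : Ed d, ∑ k : Fin d, (starRingEnd ℂ) (pd k v x) *
        pd k (fun y => ∑ j : Fin d, pd j v y * ((pdR j φ y : ℝ) : ℂ)) x) =
      (∑ j, ∑ k, ∫ x, (pdR j φ x : ℂ) * (v.pd k).pd j x * (starRingEnd ℂ) (v.pd k x)) +
      ∑ j, ∑ k, ∫ x, (pdR j (pdR k φ) x : ℂ) * v.pd j x * (starRingEnd ℂ) (v.pd k x) := by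
    simp_rw [← Finset.sum_add_distrib, ← integral_add (hT _ _) (hH _ _)]
    rw [Finset.sum_comm]
    have hTH := fun j k => (hT j k).fun_add (hH j k)
    rw [Finset.sum_congr rfl fun k _ => (integral_finsetSum _ fun j _ => hTH j k).symm,
      ← integral_finsetSum _ fun k _ => integrable_finsetSum _ fun j _ => hTH j k]
    congr 1 with x
    refine Finset.sum_congr rfl fun k _ => ?_
    rw [v.pd_sum_pd_mul hφ, Finset.mul_sum, ← SchwartzMap.coe_pd]
    exact Finset.sum_congr rfl fun j _ => by ring
  have hhess : (∫ x : Ed d, ∑ j : Fin d, ∑ k : Fin d, ((pdR j (pdR k φ) x : ℝ) : ℂ) *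
        pd j v x * (starRingEnd ℂ) (pd k v x)) =
      ∑ j, ∑ k, ∫ x, (pdR j (pdR k φ) x : ℂ) * v.pd j x * (starRingEnd ℂ) (v.pd k x) := by
    simp_rw [← SchwartzMap.coe_pd]
    rw [integral_finsetSum _ fun j _ => integrable_finsetSum _ fun k _ => hH j k]
    exact Finset.sum_congr rfl fun j _ => integral_finsetSum _ fun k _ => hH j k
  have hlap : (∫ x : Ed d, (∑ j : Fin d, ‖pd j v x‖ ^ 2) * lapR φ x) =
      ∑ j, ∑ k, ∫ x, pdR j (pdR j φ) x * ‖v.pd k x‖ ^ 2 := by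
    rw [Finset.sum_congr rfl fun j _ => (integral_finsetSum _ fun k _ => hN j k).symm,
      ← integral_finsetSum _ fun j _ => integrable_finsetSum _ fun k _ => hN j k]
    congr 1 with x
    simp_rw [← SchwartzMap.coe_pd, lapR, ← Finset.mul_sum, ← Finset.sum_mul]
    ring
  have hreal : (starRingEnd ℂ) (∑ j, ∑ k, ∫ x,
        (pdR j (pdR k φ) x : ℂ) * v.pd j x * (starRingEnd ℂ) (v.pd k x)) =
      ∑ j, ∑ k, ∫ x, (pdR j (pdR k φ) x : ℂ) * v.pd j x * (starRingEnd ℂ) (v.pd k x) := by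
    simp_rw [map_sum, ← integral_conj]
    rw [Finset.sum_comm]
    refine Finset.sum_congr rfl fun j _ => Finset.sum_congr rfl fun k _ => ?_
    congr 1 with x
    rw [pdR_comm hφ k j]
    simp only [map_mul, Complex.conj_ofReal, Complex.conj_conj]
    ring
  rw [hleft, hhess, hlap, Complex.add_re, Complex.ofReal_add, Complex.conj_eq_iff_re.mp hreal]
  simp_rw [Complex.re_sum, fun j k => (v.pd k).re_integral_mul_pd_mul_conj j (hφ.pdR j) (hb₁ j)
    (hb₂ j j), Finset.sum_neg_distrib, ← Finset.mul_sum, Complex.ofReal_neg]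
  ring

end
end

section
/- Let $d \ge 1$. There is a constant $C = C(d)$ such that for every Schwartz function $u$ on $\mathbb{R}^d$ and every smooth $\varphi : \mathbb{R}^d \to \mathbb{R}$ with $\nabla\varphi \in W^{2,\infty}$ (i.e. all partial derivatives of $\varphi$ of orders $1, 2, 3$ are bounded): $\left| \int_{\mathbb{R}^d} \bar u\, (\nabla u \cdot \nabla\varphi)\, dx \right| \le C\, \|u\|_{H^{1/2}}^2\, \|\nabla\varphi\|_{W^{2,\infty}}$, where $\|\nabla\varphi\|_{W^{2,\infty}} := \max_{1 \le |\alpha| \le 3} \|\partial^\alpha \varphi\|_{L^\infty(\mathbb{R}^d)}$. -/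
open MeasureTheory Complex
open scoped ENNReal BigOperators RealInnerProductSpace

noncomputable section

lemma rational_increment_le {t : ℝ} (ht : 0 < t) :
    2 * ((1 + (t / 2) ^ 2)⁻¹ - (1 + t ^ 2)⁻¹) ^ 2 +
      t ^ 2 * ((1 + (t / 2) ^ 2)⁻¹ ^ 2 + (1 + t ^ 2)⁻¹ ^ 2) ≤
    25 * t * (t / (1 + t) - t / 2 / (1 + t / 2)) := by
  have e1 : (1 + (t / 2) ^ 2)⁻¹ = 4 / (4 + t ^ 2) := by field_simp; ring
  have e2 : t / (1 + t) - t / 2 / (1 + t / 2) = t / ((1 + t) * (2 + t)) := by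
    field_simp; ring
  have h1 : 1 / (4 * (1 + t ^ 2)) ≤ 1 / ((1 + t) * (2 + t)) := by
    apply one_div_le_one_div_of_le (by positivity)
    nlinarith [sq_nonneg (t - 1)]
  have h2 : 4 / (4 + t ^ 2) - (1 + t ^ 2)⁻¹ = 3 * t ^ 2 / ((1 + t ^ 2) * (4 + t ^ 2)) := by
    field_simp; ring
  have h3 : 2 * (3 * t ^ 2 / ((1 + t ^ 2) * (4 + t ^ 2))) ^ 2 ≤ t ^ 2 * (9 / 8 / (1 + t ^ 2)) := by
    rw [div_pow, ← mul_div_assoc, ← mul_div_assoc, div_le_div_iff₀ (by positivity) (by positivity)]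
    have : 0 ≤ t ^ 2 := by positivity
    nlinarith [mul_nonneg this this, mul_nonneg this (mul_nonneg this this),
      mul_nonneg (mul_nonneg this this) (mul_nonneg this this),
      mul_nonneg (mul_nonneg this this) (mul_nonneg this (mul_nonneg this this))]
  have h4 : (4 / (4 + t ^ 2)) ^ 2 ≤ 4 / (1 + t ^ 2) := by
    rw [div_pow, div_le_div_iff₀ (by positivity) (by positivity)]
    nlinarith [sq_nonneg t, sq_nonneg (t ^ 2)]
  have h5 : ((1 + t ^ 2)⁻¹) ^ 2 ≤ 1 / (1 + t ^ 2) := by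
    rw [inv_pow, ← one_div]
    apply one_div_le_one_div_of_le (by positivity)
    nlinarith [sq_nonneg t, sq_nonneg (t ^ 2)]
  rw [e1, e2, h2]
  have ht2 : 0 < t ^ 2 := by positivity
  calc _ ≤ t ^ 2 * (9 / 8 / (1 + t ^ 2)) + t ^ 2 * (4 / (1 + t ^ 2) + 1 / (1 + t ^ 2)) := by
        gcongr
    _ ≤ 25 * t ^ 2 * (1 / (4 * (1 + t ^ 2))) := by
        have : t ^ 2 * (9 / 8 / (1 + t ^ 2)) + t ^ 2 * (4 / (1 + t ^ 2) + 1 / (1 + t ^ 2))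
          = t ^ 2 * (49 / 8) * (1 / (1 + t ^ 2)) := by ring
        have h' : 25 * t ^ 2 * (1 / (4 * (1 + t ^ 2))) =
            t ^ 2 * (50 / 8) * (1 / (1 + t ^ 2)) := by field_simp; ring
        rw [this, h']
        gcongr
        norm_num
    _ ≤ 25 * t ^ 2 * (1 / ((1 + t) * (2 + t))) := by gcongr
    _ = _ := by ring

section DyadicMultipliers

variable {E : Type*} [NormedAddCommGroup E]

/-- The Japanese bracket `(1 + |2πη|²)^{1/2}`, in the frequency variable of Mathlib's `𝓕`. -/
def bracket (η : E) : ℝ := Real.sqrt (1 + (2 * Real.pi * ‖η‖) ^ 2)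

lemma bracket_sq (η : E) : bracket η ^ 2 = 1 + (2 * Real.pi * ‖η‖) ^ 2 :=
  Real.sq_sqrt (by positivity)

lemma one_le_bracket (η : E) : 1 ≤ bracket η := by
  rw [bracket, Real.one_le_sqrt]
  nlinarith [sq_nonneg (2 * Real.pi * ‖η‖)]

@[fun_prop]
lemma continuous_bracket : Continuous (bracket : E → ℝ) := by
  unfold bracket; fun_prop

/-- The multiplier `(1 + 4⁻ᵏ⟨η⟩²)⁻¹`, a smooth cutoff to frequencies `≲ 2ᵏ`. -/
def lowPass (k : ℕ) (η : E) : ℝ := (1 + (bracket η / 2 ^ k) ^ 2)⁻¹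

/-- `g(⟨η⟩ / 2ᵏ)` for `g(t) = t / (1 + t)`; its increments in `k` control the dyadic pieces. -/
def dyadicProfile (k : ℕ) (η : E) : ℝ := (bracket η / 2 ^ k) / (1 + bracket η / 2 ^ k)

lemma dyadicProfile_nonneg (k : ℕ) (η : E) : 0 ≤ dyadicProfile k η := by
  have := one_le_bracket η
  unfold dyadicProfile; positivity

lemma dyadicProfile_le_one (k : ℕ) (η : E) : dyadicProfile k η ≤ 1 := by
  have := one_le_bracket η
  unfold dyadicProfile
  rw [div_le_one (by positivity)]
  linarith

@[fun_prop]
lemma continuous_dyadicProfile (k : ℕ) : Continuous (dyadicProfile k : E → ℝ) := by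
  unfold dyadicProfile
  refine Continuous.div (by fun_prop) (by fun_prop) fun η => ?_
  have := one_le_bracket η
  positivity

lemma dyadic_increment_le (k : ℕ) (η : E) :
    2 * 2 ^ k * (lowPass (k + 1) η - lowPass k η) ^ 2 +
      (2 ^ k : ℝ)⁻¹ * (bracket η ^ 2 * (lowPass (k + 1) η ^ 2 + lowPass k η ^ 2)) ≤
    25 * bracket η * (dyadicProfile k η - dyadicProfile (k + 1) η) := by
  have hp := one_le_bracket η
  have ht : 0 < bracket η / 2 ^ k := by positivity
  have h := rational_increment_le ht
  have e : bracket η / 2 ^ (k + 1) = bracket η / 2 ^ k / 2 := by rw [pow_succ, div_mul_eq_div_div]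
  unfold lowPass dyadicProfile
  rw [e]
  generalize hb : bracket η / 2 ^ k = t at *
  have hb' : bracket η = 2 ^ k * t := by rw [← hb]; field_simp
  rw [hb']
  have h2 : (0 : ℝ) < 2 ^ k := by positivity
  have h' := mul_le_mul_of_nonneg_left h h2.le
  refine le_of_eq_of_le ?_ (h'.trans_eq ?_)
  · field_simp
  · ring

lemma lowPass_nonneg (k : ℕ) (η : E) : 0 ≤ lowPass k η := by
  unfold lowPass; positivity

lemma lowPass_le_one (k : ℕ) (η : E) : lowPass k η ≤ 1 := by
  unfold lowPass
  exact inv_le_one_of_one_le₀ (by nlinarith [sq_nonneg (bracket η / 2 ^ k)])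

lemma sq_one_sub_lowPass_le (k : ℕ) (η : E) :
    (1 - lowPass k η) ^ 2 ≤ (bracket η / 2 ^ k) ^ 2 := by
  have h0 := lowPass_nonneg k η
  have h1 := lowPass_le_one k η
  have : 1 - lowPass k η ≤ (bracket η / 2 ^ k) ^ 2 := by
    have h : (1 + (bracket η / 2 ^ k) ^ 2) * lowPass k η = 1 :=
      mul_inv_cancel₀ (by positivity)
    nlinarith [mul_nonneg (sq_nonneg (bracket η / 2 ^ k)) (sub_nonneg.2 h1)]
  nlinarith

end DyadicMultipliers

lemma hasTemperateGrowth_lowPass {E : Type*} [NormedAddCommGroup E] [InnerProductSpace ℝ E]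
    (k : ℕ) : (lowPass k : E → ℝ).HasTemperateGrowth := by
  set A : ℝ := 1 + (1 / 2 ^ k) ^ 2 with hA
  have hA0 : 0 < A := by positivity
  have h1 : (fun η : E => A⁻¹ * (1 + ‖(2 * Real.pi / 2 ^ k / Real.sqrt A) • η‖ ^ 2) ^ (-1 : ℝ)
      ).HasTemperateGrowth :=
    (Function.HasTemperateGrowth.const A⁻¹).mul
      ((Function.hasTemperateGrowth_one_add_norm_sq_rpow E (-1)).comp
        ((2 * Real.pi / 2 ^ k / Real.sqrt A) • ContinuousLinearMap.id ℝ E).hasTemperateGrowth)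
  convert h1 using 2 with η
  rw [lowPass, Real.rpow_neg_one, ← mul_inv, norm_smul, mul_pow, Real.norm_eq_abs, sq_abs,
    div_pow (_ / _) (Real.sqrt A), Real.sq_sqrt hA0.le, div_pow (bracket η), bracket_sq]
  congr 1
  field_simp
  rw [hA]
  field_simp
  ring

section HalfOrderForm

open FourierTransform LineDeriv SchwartzMap

variable {E : Type*} [NormedAddCommGroup E] [InnerProductSpace ℝ E] [FiniteDimensional ℝ E]
  [MeasurableSpace E] [BorelSpace E]

lemma integrable_mul_norm_sq (f : 𝓢(E, ℂ)) {w : E → ℝ} (hw : Continuous w) {C : ℝ}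
    (hC : ∀ η, |w η| ≤ C * bracket η ^ 2) : Integrable (fun η => w η * ‖f η‖ ^ 2) := by
  obtain ⟨B, hB⟩ : ∃ B, ∀ x, ‖f x‖ ≤ B :=
    ⟨_, fun x => f.norm_le_seminorm ℝ x⟩
  have h0 := f.integrable_pow_mul volume 0
  have h2 := f.integrable_pow_mul volume 2
  have hi : Integrable (fun η => C * B * (‖η‖ ^ 0 * ‖f η‖ +
      (2 * Real.pi) ^ 2 * (‖η‖ ^ 2 * ‖f η‖))) :=
    (h0.add (h2.const_mul _)).const_mul _
  refine hi.mono' (by fun_prop) (Filter.Eventually.of_forall fun η => ?_)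
  rw [norm_mul, norm_pow, norm_norm, Real.norm_eq_abs]
  calc |w η| * ‖f η‖ ^ 2 ≤ (C * bracket η ^ 2) * ‖f η‖ ^ 2 := by gcongr; exact hC η
    _ = (C * bracket η ^ 2 * ‖f η‖) * ‖f η‖ := by ring
    _ ≤ (C * bracket η ^ 2 * ‖f η‖) * B := by
        have : 0 ≤ C * bracket η ^ 2 := (abs_nonneg _).trans (hC η)
        gcongr
        exact hB η
    _ = _ := by rw [bracket_sq]; ring

lemma integrable_norm_sq (f : 𝓢(E, ℂ)) : Integrable (fun η => ‖f η‖ ^ 2) := by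
  simpa using integrable_mul_norm_sq f (w := fun _ => 1) (C := 1) continuous_const
    (fun η => by rw [abs_one, one_mul]; exact one_le_pow₀ (one_le_bracket η))

lemma integrable_bracket_sq_mul (f : 𝓢(E, ℂ)) :
    Integrable (fun η => bracket η ^ 2 * ‖f η‖ ^ 2) :=
  integrable_mul_norm_sq f (C := 1) (by fun_prop) (fun η => by simp)

lemma integral_norm_sq_lineDeriv_add_le (f : 𝓢(E, ℂ)) {v : E} (hv : ‖v‖ ≤ 1) :
    (∫ x, ‖(∂_{v} f) x‖ ^ 2) + ∫ x, ‖f x‖ ^ 2 ≤ ∫ η, bracket η ^ 2 * ‖𝓕 f η‖ ^ 2 := by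
  rw [← integral_norm_sq_fourier, ← integral_norm_sq_fourier f,
    ← integral_add (integrable_norm_sq _) (integrable_norm_sq _)]
  refine integral_mono ((integrable_norm_sq _).add (integrable_norm_sq _))
    (integrable_bracket_sq_mul _) fun η => ?_
  have hg : (inner ℝ · v : E → ℝ).HasTemperateGrowth := by fun_prop
  have h1 : ‖𝓕 (∂_{v} f) η‖ ≤ 2 * Real.pi * ‖η‖ * ‖𝓕 f η‖ := by
    rw [fourier_lineDerivOp_eq]
    simp only [_root_.smul_apply, smulLeftCLM_apply_apply hg, norm_smul]
    have h2 : ‖inner ℝ η v‖ ≤ ‖η‖ :=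
      (norm_inner_le_norm η v).trans (mul_le_of_le_one_right (norm_nonneg _) hv)
    have h3 : ‖(2 * Real.pi * Complex.I : ℂ)‖ = 2 * Real.pi := by
      simp [abs_of_pos Real.pi_pos]
    rw [h3, mul_assoc (2 * Real.pi)]
    gcongr
  have h4 := pow_le_pow_left₀ (norm_nonneg _) h1 2
  simp only [bracket_sq]
  nlinarith

/-- The sesquilinear form `∫ conj f · a · ∂_v g`. -/
def transportForm (a : E → ℝ) (v : E) (f g : 𝓢(E, ℂ)) : ℂ :=
  ∫ x, (starRingEnd ℂ) (f x) * ((∂_{v} g) x * (a x : ℂ))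

lemma integrable_conj_mul_mul (f g : 𝓢(E, ℂ)) {a : E → ℝ} (ha : Continuous a) {M : ℝ}
    (hM : ∀ x, |a x| ≤ M) :
    Integrable (fun x => (starRingEnd ℂ) (f x) * (g x * (a x : ℂ))) := by
  have h1 : Integrable (fun x => M * (‖f x‖ ^ 2 + ‖g x‖ ^ 2)) :=
    ((integrable_norm_sq f).add (integrable_norm_sq g)).const_mul _
  refine h1.mono' (Continuous.aestronglyMeasurable ?_) (Filter.Eventually.of_forall fun x => ?_)
  · have := f.continuous
    have := g.continuous
    fun_prop
  · have hM0 : 0 ≤ M := (abs_nonneg _).trans (hM x)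
    simp only [norm_mul, RCLike.norm_conj, Complex.norm_real, Real.norm_eq_abs]
    calc ‖f x‖ * (‖g x‖ * |a x|) ≤ ‖f x‖ * (‖g x‖ * M) := by gcongr; exact hM x
      _ = M * (‖f x‖ * ‖g x‖) := by ring
      _ ≤ _ := by
        gcongr
        nlinarith [sq_nonneg (‖f x‖ - ‖g x‖), sq_nonneg (‖f x‖), sq_nonneg (‖g x‖)]

lemma norm_integral_conj_mul_mul_le (f g : 𝓢(E, ℂ)) {a : E → ℝ} {M : ℝ}
    (hM : ∀ x, |a x| ≤ M) {r : ℝ} (hr : 0 < r) :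
    ‖∫ x, (starRingEnd ℂ) (f x) * (g x * (a x : ℂ))‖ ≤
      M * (r / 2 * (∫ x, ‖f x‖ ^ 2) + r⁻¹ / 2 * ∫ x, ‖g x‖ ^ 2) := by
  rw [← integral_const_mul, ← integral_const_mul, ← integral_add
    ((integrable_norm_sq f).const_mul _) ((integrable_norm_sq g).const_mul _),
    ← integral_const_mul]
  refine norm_integral_le_of_norm_le ((((integrable_norm_sq f).const_mul _).add
    ((integrable_norm_sq g).const_mul _)).const_mul _) (Filter.Eventually.of_forall fun x => ?_)
  have hM0 : 0 ≤ M := (abs_nonneg _).trans (hM x)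
  simp only [norm_mul, RCLike.norm_conj, Complex.norm_real, Real.norm_eq_abs]
  calc ‖f x‖ * (‖g x‖ * |a x|) ≤ ‖f x‖ * (‖g x‖ * M) := by gcongr; exact hM x
    _ = M * (‖f x‖ * ‖g x‖) := by ring
    _ ≤ _ := by
      gcongr
      have h : r / 2 * ‖f x‖ ^ 2 + r⁻¹ / 2 * ‖g x‖ ^ 2 - ‖f x‖ * ‖g x‖
          = r⁻¹ / 2 * (r * ‖f x‖ - ‖g x‖) ^ 2 := by
        field_simp; ring
      have : 0 ≤ r⁻¹ / 2 * (r * ‖f x‖ - ‖g x‖) ^ 2 := by positivity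
      linarith

lemma transportForm_eq_neg {a : E → ℝ} (ha : ContDiff ℝ 1 a) {M : ℝ} (hM : ∀ x, |a x| ≤ M)
    {v : E} (hM' : ∀ x, |fderiv ℝ a x v| ≤ M) (f g : 𝓢(E, ℂ)) :
    transportForm a v f g =
      -((∫ x, (starRingEnd ℂ) ((∂_{v} f) x) * (g x * (a x : ℂ))) +
        ∫ x, (starRingEnd ℂ) (f x) * (g x * ((fderiv ℝ a x v : ℝ) : ℂ))) := by
  have ha' : Continuous (fun x => fderiv ℝ a x v) :=
    (ha.continuous_fderiv one_ne_zero).clm_apply continuous_const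
  have hder : ∀ x, HasFDerivAt (fun x => (starRingEnd ℂ) (f x) * (a x : ℂ))
      ((starRingEnd ℂ) (f x) • (Complex.ofRealCLM.comp (fderiv ℝ a x)) +
        (a x : ℂ) • ((Complex.conjCLE : ℂ →L[ℝ] ℂ).comp (fderiv ℝ f x))) x := by
    intro x
    have h1 : HasFDerivAt (fun x => (starRingEnd ℂ) (f x))
        ((Complex.conjCLE : ℂ →L[ℝ] ℂ).comp (fderiv ℝ f x)) x :=
      (Complex.conjCLE : ℂ →L[ℝ] ℂ).hasFDerivAt.comp x (f.hasFDerivAt x)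
    have h2 : HasFDerivAt (fun x => (a x : ℂ)) (Complex.ofRealCLM.comp (fderiv ℝ a x)) x :=
      Complex.ofRealCLM.hasFDerivAt.comp x
        ((ha.differentiable one_ne_zero) x).hasFDerivAt
    exact h1.mul h2
  have hval : ∀ x, fderiv ℝ (fun x => (starRingEnd ℂ) (f x) * (a x : ℂ)) x v * g x =
      (starRingEnd ℂ) ((∂_{v} f) x) * (g x * (a x : ℂ)) +
        (starRingEnd ℂ) (f x) * (g x * ((fderiv ℝ a x v : ℝ) : ℂ)) := by
    intro x
    rw [(hder x).fderiv, lineDerivOp_apply_eq_fderiv]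
    simp
    ring
  have i1 := integrable_conj_mul_mul (∂_{v} f) g ha.continuous hM
  have i2 := integrable_conj_mul_mul f g ha' hM'
  have i3 := integrable_conj_mul_mul f (∂_{v} g) ha.continuous hM
  have i4 := integrable_conj_mul_mul f g ha.continuous hM
  have key := integral_mul_fderiv_eq_neg_fderiv_mul_of_integrable (μ := (volume : Measure E))
    (f := fun x => (starRingEnd ℂ) (f x) * (a x : ℂ)) (g := fun x => g x) (v := v)
    ((i1.add i2).congr (Filter.Eventually.of_forall fun x => (hval x).symm))
    (i3.congr (Filter.Eventually.of_forall fun x => by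
      simp only [lineDerivOp_apply_eq_fderiv]; ring))
    (i4.congr (Filter.Eventually.of_forall fun x => by ring))
    (fun x _ => (hder x).differentiableAt) (fun x _ => g.differentiableAt)
  simp only [hval] at key
  rw [integral_add i1 i2] at key
  rw [← key, transportForm]
  congr 1
  ext x
  rw [lineDerivOp_apply_eq_fderiv]
  ring

lemma transportForm_self_sub_self {a : E → ℝ} (ha : Continuous a) {M : ℝ}
    (hM : ∀ x, |a x| ≤ M) (v : E) (f g : 𝓢(E, ℂ)) :
    transportForm a v f f - transportForm a v g g =
      transportForm a v (f - g) f + transportForm a v g (f - g) := by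
  have i := fun p q : 𝓢(E, ℂ) => integrable_conj_mul_mul p (∂_{v} q) ha hM
  unfold transportForm
  rw [← integral_sub (i f f) (i g g), ← integral_add (i _ _) (i _ _)]
  congr 1
  ext x
  simp only [sub_eq_add_neg, lineDerivOp_add, lineDerivOp_neg, _root_.add_apply, _root_.neg_apply,
    map_add, map_neg]
  ring

/-- Quantitative continuity of the diagonal of `transportForm`, at scale `r`. -/
lemma norm_transportForm_self_sub_self_le {a : E → ℝ} (ha : ContDiff ℝ 1 a) {M : ℝ}
    (hM : ∀ x, |a x| ≤ M) {v : E} (hv : ‖v‖ ≤ 1) (hM' : ∀ x, |fderiv ℝ a x v| ≤ M)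
    (f g : 𝓢(E, ℂ)) {r : ℝ} (hr : 0 < r) :
    ‖transportForm a v f f - transportForm a v g g‖ ≤
      M * ∫ η, (2 * r * ‖𝓕 (f - g) η‖ ^ 2 +
        r⁻¹ * (bracket η ^ 2 * ‖𝓕 f η‖ ^ 2 + bracket η ^ 2 * ‖𝓕 g η‖ ^ 2)) := by
  have hM0 : 0 ≤ M := (abs_nonneg _).trans (hM 0)
  rw [transportForm_self_sub_self ha.continuous hM,
    transportForm_eq_neg ha hM hM' g (f - g)]
  have b1 := norm_integral_conj_mul_mul_le (f - g) (∂_{v} f) hM hr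
  have b2 := norm_integral_conj_mul_mul_le (∂_{v} g) (f - g) hM (inv_pos.2 hr)
  have b3 := norm_integral_conj_mul_mul_le g (f - g) hM' (inv_pos.2 hr)
  have c1 := integral_norm_sq_lineDeriv_add_le f hv
  have c2 := integral_norm_sq_lineDeriv_add_le g hv
  have hD : 0 ≤ ∫ x, ‖(f - g) x‖ ^ 2 := by positivity
  have hf : 0 ≤ ∫ x, ‖f x‖ ^ 2 := by positivity
  have hdf : 0 ≤ ∫ x, ‖(∂_{v} f) x‖ ^ 2 := by positivity
  have hg : 0 ≤ ∫ x, ‖g x‖ ^ 2 := by positivity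
  have hdg : 0 ≤ ∫ x, ‖(∂_{v} g) x‖ ^ 2 := by positivity
  have hi : Integrable (fun η => bracket η ^ 2 * ‖𝓕 f η‖ ^ 2 + bracket η ^ 2 * ‖𝓕 g η‖ ^ 2) :=
    (integrable_bracket_sq_mul _).add (integrable_bracket_sq_mul _)
  rw [integral_add ((integrable_norm_sq _).const_mul _) (hi.const_mul _),
    integral_const_mul, integral_const_mul,
    integral_add (integrable_bracket_sq_mul _) (integrable_bracket_sq_mul _),
    integral_norm_sq_fourier]
  rw [inv_inv] at b2 b3
  have hri : 0 < r⁻¹ := inv_pos.2 hr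
  refine (norm_add_le _ _).trans ?_
  rw [norm_neg]
  refine (add_le_add b1 ((norm_add_le _ _).trans (add_le_add b2 b3))).trans ?_
  rw [← mul_add, ← mul_add]
  refine mul_le_mul_of_nonneg_left ?_ hM0
  nlinarith [mul_le_mul_of_nonneg_left c1 hri.le, mul_le_mul_of_nonneg_left c2 hri.le,
    mul_nonneg hr.le hD, mul_nonneg hri.le hf, mul_nonneg hri.le hdf, mul_nonneg hri.le hg,
    mul_nonneg hri.le hdg]

/-- The smooth low-frequency truncation of `u` at frequency `2ᵏ`. -/
def lowFreq (k : ℕ) (u : 𝓢(E, ℂ)) : 𝓢(E, ℂ) :=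
  fourierMultiplierCLM ℂ (lowPass k : E → ℝ) u

lemma fourier_lowFreq (k : ℕ) (u : 𝓢(E, ℂ)) (η : E) :
    𝓕 (lowFreq k u) η = (lowPass k η : ℂ) * 𝓕 u η := by
  rw [lowFreq, fourierMultiplierCLM_apply, fourier_fourierInv_eq,
    smulLeftCLM_apply_apply (hasTemperateGrowth_lowPass k)]
  simp

lemma fourier_sub_apply (f g : 𝓢(E, ℂ)) (η : E) : 𝓕 (f - g) η = 𝓕 f η - 𝓕 g η := by
  rw [← fourierCLM_apply (R := ℂ), map_sub, _root_.sub_apply]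
  rfl

lemma norm_sq_fourier_lowFreq (k : ℕ) (u : 𝓢(E, ℂ)) (η : E) :
    ‖𝓕 (lowFreq k u) η‖ ^ 2 = lowPass k η ^ 2 * ‖𝓕 u η‖ ^ 2 := by
  rw [fourier_lowFreq, norm_mul, mul_pow, Complex.norm_real, Real.norm_eq_abs, sq_abs]

lemma norm_transportForm_lowFreq_zero_le {a : E → ℝ} {M : ℝ}
    (hM : ∀ x, |a x| ≤ M) {v : E} (hv : ‖v‖ ≤ 1) (u : 𝓢(E, ℂ)) :
    ‖transportForm a v (lowFreq 0 u) (lowFreq 0 u)‖ ≤ M * ∫ η, bracket η * ‖𝓕 u η‖ ^ 2 := by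
  have hM0 : 0 ≤ M := (abs_nonneg _).trans (hM 0)
  refine (norm_integral_conj_mul_mul_le _ _ hM one_pos).trans ?_
  refine mul_le_mul_of_nonneg_left ?_ hM0
  have c := integral_norm_sq_lineDeriv_add_le (lowFreq 0 u) hv
  have d1 : 0 ≤ ∫ x, ‖(∂_{v} (lowFreq 0 u)) x‖ ^ 2 := by positivity
  have d2 : 0 ≤ ∫ x, ‖(lowFreq 0 u) x‖ ^ 2 := by positivity
  refine le_trans (b := ∫ η, bracket η ^ 2 * ‖𝓕 (lowFreq 0 u) η‖ ^ 2) (by linarith) ?_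
  refine integral_mono (integrable_bracket_sq_mul _)
    (integrable_mul_norm_sq _ (C := 1) (by fun_prop) fun η => ?_) fun η => ?_
  · have := one_le_bracket η
    rw [abs_of_nonneg (by positivity)]
    nlinarith
  · have hp := one_le_bracket η
    simp only [norm_sq_fourier_lowFreq]
    rw [← mul_assoc]
    gcongr
    simp only [lowPass, pow_zero, div_one, inv_pow]
    rw [← div_eq_mul_inv, div_le_iff₀ (by positivity)]
    nlinarith [sq_nonneg (bracket η ^ 2), mul_pos (by linarith : 0 < bracket η)
      (by positivity : 0 < bracket η ^ 2)]

lemma integrable_profile_weight (u : 𝓢(E, ℂ)) (n : ℕ) :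
    Integrable (fun η => bracket η * (26 - 25 * dyadicProfile n η) * ‖𝓕 u η‖ ^ 2) := by
  refine integrable_mul_norm_sq (𝓕 u) (C := 26) (by fun_prop) fun η => ?_
  have h0 := dyadicProfile_nonneg n η
  have h1 := dyadicProfile_le_one n η
  have hp := one_le_bracket η
  rw [abs_of_nonneg (mul_nonneg (by linarith) (by linarith))]
  nlinarith

lemma norm_transportForm_lowFreq_le {a : E → ℝ} (ha : ContDiff ℝ 1 a) {M : ℝ}
    (hM : ∀ x, |a x| ≤ M) {v : E} (hv : ‖v‖ ≤ 1) (hM' : ∀ x, |fderiv ℝ a x v| ≤ M)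
    (u : 𝓢(E, ℂ)) (n : ℕ) :
    ‖transportForm a v (lowFreq n u) (lowFreq n u)‖ ≤
      M * ∫ η, bracket η * (26 - 25 * dyadicProfile n η) * ‖𝓕 u η‖ ^ 2 := by
  have hM0 : 0 ≤ M := (abs_nonneg _).trans (hM 0)
  induction n with
  | zero =>
    refine (norm_transportForm_lowFreq_zero_le hM hv u).trans
      (mul_le_mul_of_nonneg_left ?_ hM0)
    refine integral_mono (integrable_mul_norm_sq _ (C := 1) (by fun_prop) fun η => ?_)
      (integrable_profile_weight u 0) fun η => ?_
    · have := one_le_bracket η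
      rw [abs_of_nonneg (by positivity)]
      nlinarith
    · have hp := one_le_bracket η
      have h1 := dyadicProfile_le_one 0 η
      simp only
      gcongr
      nlinarith
  | succ k ih =>
    have hs := norm_transportForm_self_sub_self_le ha hM hv hM' (lowFreq (k + 1) u) (lowFreq k u)
      (r := 2 ^ k) (by positivity)
    have hle : (∫ η, (2 * 2 ^ k * ‖𝓕 (lowFreq (k + 1) u - lowFreq k u) η‖ ^ 2 +
        (2 ^ k : ℝ)⁻¹ * (bracket η ^ 2 * ‖𝓕 (lowFreq (k + 1) u) η‖ ^ 2 +
          bracket η ^ 2 * ‖𝓕 (lowFreq k u) η‖ ^ 2))) ≤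
        ∫ η, (bracket η * (26 - 25 * dyadicProfile (k + 1) η) * ‖𝓕 u η‖ ^ 2 -
          bracket η * (26 - 25 * dyadicProfile k η) * ‖𝓕 u η‖ ^ 2) := by
      refine integral_mono (((integrable_norm_sq _).const_mul _).add
        (((integrable_bracket_sq_mul _).add (integrable_bracket_sq_mul _)).const_mul _))
        ((integrable_profile_weight u _).sub (integrable_profile_weight u _)) fun η => ?_
      have hd : ‖𝓕 (lowFreq (k + 1) u - lowFreq k u) η‖ ^ 2 =
          (lowPass (k + 1) η - lowPass k η) ^ 2 * ‖𝓕 u η‖ ^ 2 := by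
        rw [fourier_sub_apply, fourier_lowFreq, fourier_lowFreq, ← sub_mul,
          ← Complex.ofReal_sub, norm_mul, mul_pow, Complex.norm_real, Real.norm_eq_abs, sq_abs]
      simp only [hd, norm_sq_fourier_lowFreq]
      have := mul_le_mul_of_nonneg_right (dyadic_increment_le k η) (sq_nonneg ‖𝓕 u η‖)
      refine le_of_eq_of_le ?_ (this.trans_eq ?_) <;> ring
    rw [integral_sub (integrable_profile_weight u _) (integrable_profile_weight u _)] at hle
    have := mul_le_mul_of_nonneg_left hle hM0
    have := norm_le_insert' (transportForm a v (lowFreq (k + 1) u) (lowFreq (k + 1) u))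
      (transportForm a v (lowFreq k u) (lowFreq k u))
    linarith

lemma norm_transportForm_self_le {a : E → ℝ} (ha : ContDiff ℝ 1 a) {M : ℝ}
    (hM : ∀ x, |a x| ≤ M) {v : E} (hv : ‖v‖ ≤ 1) (hM' : ∀ x, |fderiv ℝ a x v| ≤ M)
    (u : 𝓢(E, ℂ)) :
    ‖transportForm a v u u‖ ≤ 26 * M * ∫ η, bracket η * ‖𝓕 u η‖ ^ 2 := by
  have hM0 : 0 ≤ M := (abs_nonneg _).trans (hM 0)
  set K : ℝ := ∫ η, bracket η ^ 2 * ‖𝓕 u η‖ ^ 2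
  have hbound : ∀ n : ℕ, ‖transportForm a v u u‖ ≤
      26 * M * (∫ η, bracket η * ‖𝓕 u η‖ ^ 2) + M * (4 * K) * (1 / 2) ^ n := by
    intro n
    have hs := norm_transportForm_self_sub_self_le ha hM hv hM' u (lowFreq n u)
      (r := 2 ^ n) (by positivity)
    have hle : (∫ η, (2 * 2 ^ n * ‖𝓕 (u - lowFreq n u) η‖ ^ 2 +
        (2 ^ n : ℝ)⁻¹ * (bracket η ^ 2 * ‖𝓕 u η‖ ^ 2 +
          bracket η ^ 2 * ‖𝓕 (lowFreq n u) η‖ ^ 2))) ≤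
        ∫ η, 4 * (1 / 2) ^ n * (bracket η ^ 2 * ‖𝓕 u η‖ ^ 2) := by
      refine integral_mono (((integrable_norm_sq _).const_mul _).add
        (((integrable_bracket_sq_mul _).add (integrable_bracket_sq_mul _)).const_mul _))
        ((integrable_bracket_sq_mul _).const_mul _) fun η => ?_
      have hd : ‖𝓕 (u - lowFreq n u) η‖ ^ 2 = (1 - lowPass n η) ^ 2 * ‖𝓕 u η‖ ^ 2 := by
        rw [fourier_sub_apply, fourier_lowFreq, ← one_sub_mul,
          ← Complex.ofReal_one, ← Complex.ofReal_sub, norm_mul, mul_pow, Complex.norm_real,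
          Real.norm_eq_abs, sq_abs]
      simp only [hd, norm_sq_fourier_lowFreq]
      have h1 := sq_one_sub_lowPass_le n η
      have h2 : lowPass n η ^ 2 ≤ 1 := pow_le_one₀ (lowPass_nonneg n η) (lowPass_le_one n η)
      calc _ ≤ 2 * 2 ^ n * ((bracket η / 2 ^ n) ^ 2 * ‖𝓕 u η‖ ^ 2) +
          (2 ^ n : ℝ)⁻¹ * (bracket η ^ 2 * ‖𝓕 u η‖ ^ 2 +
            bracket η ^ 2 * (1 * ‖𝓕 u η‖ ^ 2)) := by gcongr
        _ = _ := by rw [one_div, inv_pow]; field_simp; ring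
    rw [integral_const_mul] at hle
    have h1 := mul_le_mul_of_nonneg_left hle hM0
    have h2 := norm_le_insert' (transportForm a v u u)
      (transportForm a v (lowFreq n u) (lowFreq n u))
    have h3 := norm_transportForm_lowFreq_le ha hM hv hM' u n
    have h4 : (∫ η, bracket η * (26 - 25 * dyadicProfile n η) * ‖𝓕 u η‖ ^ 2) ≤
        ∫ η, 26 * (bracket η * ‖𝓕 u η‖ ^ 2) := by
      refine integral_mono (integrable_profile_weight u n)
        ((integrable_mul_norm_sq _ (C := 1) (by fun_prop) fun η => ?_).const_mul _) fun η => ?_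
      · have := one_le_bracket η
        rw [abs_of_nonneg (by positivity)]
        nlinarith
      · have hp := one_le_bracket η
        have hn := dyadicProfile_nonneg n η
        simp only
        rw [← mul_assoc]
        refine mul_le_mul_of_nonneg_right ?_ (sq_nonneg _)
        nlinarith
    rw [integral_const_mul] at h4
    have h5 := mul_le_mul_of_nonneg_left h4 hM0
    have : M * (4 * (1 / 2) ^ n * K) = M * (4 * K) * (1 / 2) ^ n := by ring
    linarith
  have hlim : Filter.Tendsto (fun n : ℕ => 26 * M * (∫ η, bracket η * ‖𝓕 u η‖ ^ 2) +
      M * (4 * K) * (1 / 2 : ℝ) ^ n) Filter.atTop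
      (nhds (26 * M * (∫ η, bracket η * ‖𝓕 u η‖ ^ 2) + M * (4 * K) * 0)) :=
    ((tendsto_pow_atTop_nhds_zero_of_lt_one (by norm_num) (by norm_num)).const_mul _).const_add _
  rw [mul_zero, add_zero] at hlim
  exact ge_of_tendsto' hlim hbound

end HalfOrderForm

open FourierTransform in
lemma FT_eq_fourier {d : ℕ} (f : Ed d → ℂ) (ξ : Ed d) :
    FT f ξ = 𝓕 f ((2 * Real.pi)⁻¹ • ξ) := by
  rw [FT, Real.fourier_eq']
  congr 1
  ext x
  rw [smul_eq_mul, inner_smul_right]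
  congr 2
  have := Real.pi_ne_zero
  push_cast
  field_simp

open FourierTransform in
lemma H12sq_eq_integral_bracket {d : ℕ} (f : Ed d → ℂ) :
    H12sq f = ∫ η, bracket η * ‖𝓕 f η‖ ^ 2 := by
  have hpi := Real.pi_pos
  have h := Measure.integral_comp_inv_smul_of_nonneg (volume : Measure (Ed d))
    (fun η => bracket η * ‖𝓕 f η‖ ^ 2) (R := 2 * Real.pi) (by positivity)
  rw [H12sq]
  have e : ∀ ξ : Ed d, (1 + ‖ξ‖ ^ 2) ^ ((1 : ℝ) / 2) * ‖FT f ξ‖ ^ 2 =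
      bracket ((2 * Real.pi)⁻¹ • ξ) * ‖𝓕 f ((2 * Real.pi)⁻¹ • ξ)‖ ^ 2 := by
    intro ξ
    rw [FT_eq_fourier, bracket, Real.sqrt_eq_rpow, norm_smul, Real.norm_eq_abs,
      abs_of_pos (by positivity), mul_inv_cancel_left₀ (by positivity)]
  simp only [e]
  rw [h, finrank_euclideanSpace_fin, Real.rpow_neg (by positivity), Real.rpow_natCast, smul_eq_mul,
    inv_mul_cancel_left₀ (by positivity)]

lemma fderiv_fderiv_apply_eq_iteratedFDeriv {E : Type*} [NormedAddCommGroup E] [NormedSpace ℝ E]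
    {φ : E → ℝ} (hφ : ContDiff ℝ 2 φ) (x v w : E) :
    fderiv ℝ (fun y => fderiv ℝ φ y v) x w = iteratedFDeriv ℝ 2 φ x ![w, v] := by
  rw [iteratedFDeriv_two_apply]
  have h : DifferentiableAt ℝ (fderiv ℝ φ) x :=
    (hφ.fderiv_right (m := 1) (by norm_num)).differentiable one_ne_zero x
  rw [fderiv_clm_apply h (differentiableAt_const v)]
  simp

theorem stmt15 (d : ℕ) (hd : 1 ≤ d) :
    ∃ C : ℝ, 0 < C ∧ ∀ u : SchwartzMap (Ed d) ℂ, ∀ φ : Ed d → ℝ, ContDiff ℝ (⊤ : ℕ∞) φ →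
      ∀ M : ℝ, (∀ n : ℕ, 1 ≤ n → n ≤ 3 → ∀ x : Ed d, ‖iteratedFDeriv ℝ n φ x‖ ≤ M) →
      ‖∫ x : Ed d, (starRingEnd ℂ) (u x) *
          ∑ j : Fin d, pd j (⇑u) x * ((pdR j φ x : ℝ) : ℂ)‖
        ≤ C * H12sq (⇑u) * M := by
  refine ⟨26 * d, by positivity, fun u φ hφ M hM => ?_⟩
  have hb : ∀ j : Fin d, ‖(EuclideanSpace.single j 1 : Ed d)‖ = 1 := fun j => by simp
  have ha : ∀ j, ContDiff ℝ 1 (pdR j φ) := fun j =>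
    (hφ.fderiv_right (m := 1) (by norm_cast)).clm_apply contDiff_const
  have hM1 : ∀ j x, |pdR j φ x| ≤ M := fun j x => by
    have h := (fderiv ℝ φ x).le_opNorm (EuclideanSpace.single j 1)
    rw [hb, mul_one, ← norm_iteratedFDeriv_one] at h
    exact h.trans (hM 1 le_rfl (by norm_num) x)
  have hM2 : ∀ j x, |fderiv ℝ (pdR j φ) x (EuclideanSpace.single j 1)| ≤ M := fun j x => by
    have h := (iteratedFDeriv ℝ 2 φ x).le_opNorm
      ![EuclideanSpace.single j 1, EuclideanSpace.single j 1]
    rw [← fderiv_fderiv_apply_eq_iteratedFDeriv (hφ.of_le (by norm_cast))] at h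
    simp only [Fin.prod_univ_two, Matrix.cons_val_zero, Matrix.cons_val_one, hb, mul_one] at h
    exact h.trans (hM 2 (by norm_num) (by norm_num) x)
  have hsum : (∫ x : Ed d, (starRingEnd ℂ) (u x) *
      ∑ j : Fin d, pd j (⇑u) x * ((pdR j φ x : ℝ) : ℂ)) =
      ∑ j : Fin d, transportForm (pdR j φ) (EuclideanSpace.single j 1) u u := by
    simp only [Finset.mul_sum]
    exact integral_finsetSum _ fun j _ => integrable_conj_mul_mul u
      (LineDeriv.lineDerivOp (EuclideanSpace.single j (1 : ℝ) : Ed d) u : SchwartzMap (Ed d) ℂ)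
      (ha j).continuous (hM1 j)
  rw [hsum]
  refine (norm_sum_le_of_le _ fun j _ =>
    norm_transportForm_self_le (ha j) (hM1 j) (hb j).le (hM2 j) u).trans_eq ?_
  rw [H12sq_eq_integral_bracket, Finset.sum_const, Finset.card_univ, Fintype.card_fin,
    nsmul_eq_mul, SchwartzMap.fourier_coe]
  ring

end
end
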